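/- Single-edge determinant ratio monotonicity under wiring (vertex contraction): Let G = (V, E) be a finite connected graph, let W ⊆ V be nonempty with V∖W nonempty, and fix v₀ ∈ V. For κ ∈ (0,∞)^E write D(κ) = det L(κ)[V∖{v₀}] (the free reduced determinant) and D_W(κ) = det L(κ)[V∖W] (the reduced determinant of the graph obtained from G by identifying all vertices of W to a single vertex). Then for every f ∈ E, every κ ∈ (0,∞)^E, and all 0 < c_f^− < c_f^+: D(κ_f^+) · D_W(κ_f^−) ≥ D_W(κ_f^+) · D(κ_f^−). In ratio form, D(κ^+)/D(κ^−) ≥ D_W(κ^+)/D_W(κ^−). -/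

import Mathlib

open scoped Classical

/-- The weighted graph Laplacian of a finite graph `G` with conductances
`κ : Sym2 α → ℝ`. -/
noncomputable def glap {α : Type*} [Fintype α] (G : SimpleGraph α) (κ : Sym2 α → ℝ) :
    Matrix α α ℝ :=
  Matrix.of fun x y =>
    if x = y then ∑ z : α, (if G.Adj x z then κ s(x, z) else 0)
    else if G.Adj x y then -κ s(x, y) else 0

/-- The reduced determinant `det L(κ)[α∖W]`: for `W = {v₀}` this is the free reduced
determinant, and for general `W` the reduced determinant of the graph obtained by
identifying all vertices of `W` (wiring). -/
noncomputable def gdet {α : Type*} [Fintype α] (G : SimpleGraph α) (κ : Sym2 α → ℝ)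
    (W : Set α) : ℝ :=
  ((glap G κ).submatrix (fun x : {x : α // x ∉ W} => (x : α))
    (fun x : {x : α // x ∉ W} => (x : α))).det

open Matrix

theorem glap_apply_diag {α : Type*} [Fintype α] (G : SimpleGraph α) (κ : Sym2 α → ℝ) (x : α) :
    glap G κ x x = ∑ z : α, (if G.Adj x z then κ s(x, z) else 0) := by
  simp [glap]

theorem glap_apply_ne {α : Type*} [Fintype α] (G : SimpleGraph α) (κ : Sym2 α → ℝ) {x y : α}
    (h : x ≠ y) : glap G κ x y = if G.Adj x y then -κ s(x, y) else 0 := by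
  simp [glap, h]

theorem glap_isSymm {α : Type*} [Fintype α] (G : SimpleGraph α) (κ : Sym2 α → ℝ) :
    (glap G κ).IsSymm := by
  refine Matrix.IsSymm.ext fun x y => ?_
  by_cases h : x = y
  · rw [h]
  · rw [glap_apply_ne G κ h, glap_apply_ne G κ (Ne.symm h), G.adj_comm, Sym2.eq_swap]

theorem glap_mulVec {α : Type*} [Fintype α] (G : SimpleGraph α) (κ : Sym2 α → ℝ) (h : α → ℝ)
    (x : α) :
    (glap G κ *ᵥ h) x = ∑ z : α, (if G.Adj x z then κ s(x, z) else 0) * (h x - h z) := by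
  have hentry : ∀ z, glap G κ x z * h z =
      (if z = x then (∑ z : α, (if G.Adj x z then κ s(x, z) else 0)) * h x else 0)
        - (if G.Adj x z then κ s(x, z) else 0) * h z := by
    intro z
    by_cases hz : z = x
    · subst hz
      simp [glap_apply_diag]
    · rw [glap_apply_ne G κ (Ne.symm hz), if_neg hz]
      split_ifs <;> ring
  simp only [mulVec, dotProduct, hentry, Finset.sum_sub_distrib, Finset.sum_ite_eq',
    Finset.mem_univ, if_true, mul_sub, Finset.sum_mul]

/-- The Dirichlet energy identity for the weighted Laplacian. -/
theorem dotProduct_glap_mulVec {α : Type*} [Fintype α] (G : SimpleGraph α) (κ : Sym2 α → ℝ)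
    (h : α → ℝ) :
    h ⬝ᵥ glap G κ *ᵥ h =
      (∑ x, ∑ y, (if G.Adj x y then κ s(x, y) else 0) * (h x - h y) ^ 2) / 2 := by
  have h1 : h ⬝ᵥ glap G κ *ᵥ h =
      ∑ x, ∑ y, (if G.Adj x y then κ s(x, y) else 0) * (h x * (h x - h y)) := by
    simp only [dotProduct, glap_mulVec, Finset.mul_sum]
    exact Finset.sum_congr rfl fun x _ => Finset.sum_congr rfl fun y _ => by ring
  have h2 : h ⬝ᵥ glap G κ *ᵥ h =
      ∑ x, ∑ y, (if G.Adj x y then κ s(x, y) else 0) * (h y * (h y - h x)) := by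
    rw [h1, Finset.sum_comm]
    refine Finset.sum_congr rfl fun x _ => Finset.sum_congr rfl fun y _ => ?_
    rw [G.adj_comm, Sym2.eq_swap]
  rw [eq_div_iff two_ne_zero, mul_two]
  nth_rewrite 1 [h1]
  rw [h2]
  simp only [← Finset.sum_add_distrib]
  exact Finset.sum_congr rfl fun x _ => Finset.sum_congr rfl fun y _ => by ring

theorem dotProduct_glap_mulVec_sub_const {α : Type*} [Fintype α] (G : SimpleGraph α)
    (κ : Sym2 α → ℝ) (h : α → ℝ) (c : ℝ) :
    (fun x => h x - c) ⬝ᵥ glap G κ *ᵥ (fun x => h x - c) = h ⬝ᵥ glap G κ *ᵥ h := by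
  simp only [dotProduct_glap_mulVec, sub_sub_sub_cancel_right]

theorem dotProduct_glap_mulVec_pos {α : Type*} [Fintype α] {G : SimpleGraph α}
    (hconn : G.Connected) {κ : Sym2 α → ℝ} (hκ : ∀ e ∈ G.edgeSet, 0 < κ e) {h : α → ℝ}
    {v w : α} (hvw : h v ≠ h w) : 0 < h ⬝ᵥ glap G κ *ᵥ h := by
  have hnn : ∀ x y, 0 ≤ (if G.Adj x y then κ s(x, y) else 0) * (h x - h y) ^ 2 := by
    intro x y
    split_ifs with hxy
    · exact mul_nonneg (hκ _ hxy).le (sq_nonneg _)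
    · simp
  have hnn' : ∀ x, 0 ≤ ∑ y, (if G.Adj x y then κ s(x, y) else 0) * (h x - h y) ^ 2 :=
    fun x => Finset.sum_nonneg fun y _ => hnn x y
  rw [dotProduct_glap_mulVec]
  refine div_pos (lt_of_le_of_ne (Finset.sum_nonneg fun x _ => hnn' x) fun h0 => hvw ?_) two_pos
  have hadj : ∀ x y, G.Adj x y → h x = h y := by
    intro x y hxy
    have hx := (Finset.sum_eq_zero_iff_of_nonneg fun x _ => hnn' x).1 h0.symm x (Finset.mem_univ x)
    have hy := (Finset.sum_eq_zero_iff_of_nonneg fun y _ => hnn x y).1 hx y (Finset.mem_univ y)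
    rw [if_pos hxy] at hy
    exact sub_eq_zero.1 (pow_eq_zero_iff two_ne_zero |>.1
      ((mul_eq_zero.1 hy).resolve_left (hκ _ hxy).ne'))
  obtain ⟨p⟩ := hconn.preconnected v w
  induction p with
  | nil => rfl
  | cons hxy _ ih =>
    by_contra hne
    exact hne ((hadj _ _ hxy).trans (by_contra fun h' => h' (ih h')))

/-- The potential difference across the pair `a, b`, as a vector. -/
noncomputable def edgeVec {α : Type*} (a b : α) : α → ℝ := Pi.single a 1 - Pi.single b 1

theorem edgeVec_dotProduct {α : Type*} [Fintype α] (a b : α) (h : α → ℝ) :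
    edgeVec a b ⬝ᵥ h = h a - h b := by
  simp [edgeVec, sub_dotProduct]

theorem glap_update {α : Type*} [Fintype α] (G : SimpleGraph α) (κ : Sym2 α → ℝ) {a b : α}
    (hab : G.Adj a b) (c d : ℝ) :
    glap G (Function.update κ s(a, b) d) =
      glap G (Function.update κ s(a, b) c) +
        vecMulVec ((d - c) • edgeVec a b) (edgeVec a b) := by
  refine ext_of_mulVec_single fun y => ?_
  generalize (Pi.single y 1 : α → ℝ) = h
  funext x
  rw [add_mulVec, Pi.add_apply, vecMulVec_mulVec, edgeVec_dotProduct, ← sub_eq_iff_eq_add',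
    glap_mulVec, glap_mulVec, ← Finset.sum_sub_distrib]
  have hterm : ∀ z, (if G.Adj x z then Function.update κ s(a, b) d s(x, z) else 0) * (h x - h z)
      - (if G.Adj x z then Function.update κ s(a, b) c s(x, z) else 0) * (h x - h z)
      = if s(x, z) = s(a, b) then (d - c) * (h x - h z) else 0 := by
    intro z
    by_cases hz : s(x, z) = s(a, b)
    · have hxz : G.Adj x z := by
        rw [← SimpleGraph.mem_edgeSet, hz]
        exact hab
      simp only [hz, hxz, if_true, Function.update_self]
      ring
    · simp [hz]
  simp only [hterm]
  have hne := hab.ne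
  by_cases hxa : x = a
  · subst hxa
    simp [edgeVec, hne]
  · by_cases hxb : x = b
    · subst hxb
      simp [edgeVec, hne.symm]
      ring
    · simp [edgeVec, hxa, hxb]

theorem dotProduct_comp_subtype_val {α : Type*} [Fintype α] (S : Set α) (u : α → ℝ) {h : α → ℝ}
    (hS : ∀ x ∈ S, h x = 0) :
    (fun x : {x // x ∉ S} => u x) ⬝ᵥ (fun x : {x // x ∉ S} => h x) = u ⬝ᵥ h := by
  have hsum := Fintype.sum_subtype_add_sum_subtype (fun x => x ∉ S) fun x => u x * h x
  rw [Finset.sum_eq_zero (s := (Finset.univ : Finset {x // ¬ x ∉ S}))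
    fun x _ => by rw [hS _ (not_not.1 x.2), mul_zero], add_zero] at hsum
  exact hsum

/-- The Laplacian with Dirichlet boundary condition on `S`. -/
noncomputable def dirichletLap {α : Type*} [Fintype α] (G : SimpleGraph α) (κ : Sym2 α → ℝ)
    (S : Set α) : Matrix {x // x ∉ S} {x // x ∉ S} ℝ :=
  (glap G κ).submatrix (fun x => (x : α)) (fun x => (x : α))

theorem dotProduct_dirichletLap_mulVec {α : Type*} [Fintype α] (G : SimpleGraph α)
    (κ : Sym2 α → ℝ) (S : Set α) {h : α → ℝ} (hS : ∀ x ∈ S, h x = 0) :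
    (fun x : {x // x ∉ S} => h x) ⬝ᵥ dirichletLap G κ S *ᵥ (fun x : {x // x ∉ S} => h x) =
      h ⬝ᵥ glap G κ *ᵥ h := by
  have hmul : dirichletLap G κ S *ᵥ (fun x : {x // x ∉ S} => h x) =
      fun x : {x // x ∉ S} => (glap G κ *ᵥ h) x :=
    funext fun x => dotProduct_comp_subtype_val S (glap G κ x) hS
  rw [hmul, dotProduct_comm, dotProduct_comp_subtype_val S _ hS, dotProduct_comm]

theorem exists_eq_comp_subtype_val {α : Type*} (S : Set α) (g : {x // x ∉ S} → ℝ) :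
    ∃ h : α → ℝ, (∀ x ∈ S, h x = 0) ∧ g = fun x : {x // x ∉ S} => h x := by
  refine ⟨fun x => if hx : x ∉ S then g ⟨x, hx⟩ else 0, fun x hx => dif_neg (not_not.2 hx), ?_⟩
  funext x
  simp only [x.2, not_false_eq_true, dite_true]

theorem dirichletLap_posDef {α : Type*} [Fintype α] {G : SimpleGraph α}
    (hconn : G.Connected) {κ : Sym2 α → ℝ} (hκ : ∀ e ∈ G.edgeSet, 0 < κ e) {S : Set α}
    (hS : S.Nonempty) : (dirichletLap G κ S).PosDef := by
  refine PosDef.of_dotProduct_mulVec_pos ?_ fun g hg => ?_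
  · exact isHermitian_iff_isSymm.2 ((glap_isSymm G κ).submatrix _)
  · obtain ⟨h, h0, rfl⟩ := exists_eq_comp_subtype_val S g
    obtain ⟨v, hv⟩ := Function.ne_iff.1 hg
    obtain ⟨w, hw⟩ := hS
    rw [star_trivial, dotProduct_dirichletLap_mulVec G κ S h0]
    refine dotProduct_glap_mulVec_pos hconn hκ (v := v) (w := w) ?_
    rw [h0 w hw]
    exact hv

/-- The variational lower bound on the quadratic form of the inverse of a positive definite
matrix. -/
theorem Matrix.PosDef.two_mul_dotProduct_sub_le {n : Type*} [Fintype n] [DecidableEq n]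
    {A : Matrix n n ℝ} (hA : A.PosDef) (u h : n → ℝ) :
    2 * (u ⬝ᵥ h) - h ⬝ᵥ A *ᵥ h ≤ u ⬝ᵥ A⁻¹ *ᵥ u := by
  have hdet : IsUnit A.det := (isUnit_iff_isUnit_det A).1 hA.isUnit
  have hAk : A *ᵥ (A⁻¹ *ᵥ u) = u := by rw [mulVec_mulVec, mul_nonsing_inv A hdet, one_mulVec]
  have hsymm : Aᵀ = A := isHermitian_iff_isSymm.1 hA.isHermitian
  have hnn := hA.posSemidef.dotProduct_mulVec_nonneg (h - A⁻¹ *ᵥ u)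
  have hcross : (A⁻¹ *ᵥ u) ⬝ᵥ A *ᵥ h = u ⬝ᵥ h := by
    rw [dotProduct_mulVec, ← mulVec_transpose, hsymm, hAk]
  rw [star_trivial, mulVec_sub, hAk, sub_dotProduct, dotProduct_sub, dotProduct_sub, hcross,
    dotProduct_comm h u, dotProduct_comm _ u] at hnn
  linarith

/-- The effective resistance between `a` and `b` in the network with `S` grounded. -/
noncomputable def effRes {α : Type*} [Fintype α] (G : SimpleGraph α) (κ : Sym2 α → ℝ)
    (S : Set α) (a b : α) : ℝ :=
  (fun x : {x // x ∉ S} => edgeVec a b x) ⬝ᵥ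
    (dirichletLap G κ S)⁻¹ *ᵥ (fun x : {x // x ∉ S} => edgeVec a b x)

theorem two_mul_sub_energy_le_effRes {α : Type*} [Fintype α] {G : SimpleGraph α}
    (hconn : G.Connected) {κ : Sym2 α → ℝ} (hκ : ∀ e ∈ G.edgeSet, 0 < κ e) {S : Set α}
    (hS : S.Nonempty) (a b : α) {h : α → ℝ} (h0 : ∀ x ∈ S, h x = 0) :
    2 * (h a - h b) - h ⬝ᵥ glap G κ *ᵥ h ≤ effRes G κ S a b := by
  have hvar := (dirichletLap_posDef hconn hκ hS).two_mul_dotProduct_sub_le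
    (fun x => edgeVec a b x) (fun x => h x)
  rwa [dotProduct_dirichletLap_mulVec G κ S h0, dotProduct_comp_subtype_val S _ h0,
    edgeVec_dotProduct] at hvar

/-- Thomson-type monotonicity: grounding a set does not exceed the free resistance. -/
theorem effRes_le_effRes_singleton {α : Type*} [Fintype α] {G : SimpleGraph α}
    (hconn : G.Connected) {κ : Sym2 α → ℝ} (hκ : ∀ e ∈ G.edgeSet, 0 < κ e) {S : Set α}
    (hS : S.Nonempty) (v a b : α) : effRes G κ S a b ≤ effRes G κ {v} a b := by
  have hP := dirichletLap_posDef hconn hκ hS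
  have hdet := (isUnit_iff_isUnit_det _).1 hP.isUnit
  obtain ⟨h, h0, hh⟩ := exists_eq_comp_subtype_val S
    ((dirichletLap G κ S)⁻¹ *ᵥ (fun x : {x // x ∉ S} => edgeVec a b x))
  have hlin : effRes G κ S a b = h a - h b := by
    rw [effRes, hh, dotProduct_comp_subtype_val S _ h0, edgeVec_dotProduct]
  have henergy : h ⬝ᵥ glap G κ *ᵥ h = h a - h b := by
    rw [← dotProduct_dirichletLap_mulVec G κ S h0, ← hh, mulVec_mulVec, mul_nonsing_inv _ hdet,
      one_mulVec, dotProduct_comm, ← hlin, effRes]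
  have hv0 : ∀ x ∈ ({v} : Set α), (fun x => h x - h v) x = 0 := by
    rintro x rfl
    exact sub_self _
  have hvar := two_mul_sub_energy_le_effRes hconn hκ (Set.singleton_nonempty v) a b hv0
  rw [dotProduct_glap_mulVec_sub_const, henergy] at hvar
  linarith

theorem gdet_pos {α : Type*} [Fintype α] {G : SimpleGraph α} (hconn : G.Connected)
    {κ : Sym2 α → ℝ} (hκ : ∀ e ∈ G.edgeSet, 0 < κ e) {S : Set α} (hS : S.Nonempty) :
    0 < gdet G κ S :=
  (dirichletLap_posDef hconn hκ hS).det_pos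

theorem gdet_update {α : Type*} [Fintype α] {G : SimpleGraph α} {κ : Sym2 α → ℝ} {S : Set α}
    {a b : α} (hab : G.Adj a b) (c d : ℝ)
    (hdet : IsUnit (dirichletLap G (Function.update κ s(a, b) c) S).det) :
    gdet G (Function.update κ s(a, b) d) S =
      gdet G (Function.update κ s(a, b) c) S *
        (1 + (d - c) * effRes G (Function.update κ s(a, b) c) S a b) := by
  have hsub : dirichletLap G (Function.update κ s(a, b) d) S =
      dirichletLap G (Function.update κ s(a, b) c) S +
        replicateCol Unit ((d - c) • fun x : {x // x ∉ S} => edgeVec a b x) *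
          replicateRow Unit (fun x : {x // x ∉ S} => edgeVec a b x) := by
    rw [dirichletLap, glap_update G κ hab c d, ← vecMulVec_eq]
    rfl
  change (dirichletLap G _ S).det = (dirichletLap G _ S).det * _
  rw [hsub, det_add_replicateCol_mul_replicateRow hdet, Matrix.mul_assoc,
    ← replicateCol_mulVec, det_unique (n := Unit), Matrix.add_apply, Matrix.one_apply_eq,
    replicateRow_mul_replicateCol_apply, mulVec_smul, dotProduct_smul, smul_eq_mul, effRes]

/-- **Single-edge determinant ratio monotonicity under wiring (vertex contraction)**:
`D(κ⁺)·D_W(κ⁻) ≥ D_W(κ⁺)·D(κ⁻)` where `D(κ) = det L(κ)[V∖{v₀}]` and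
`D_W(κ) = det L(κ)[V∖W]`. -/
theorem wired_det_ratio_mono
    {V : Type*} [Fintype V] (G : SimpleGraph V) (hconn : G.Connected)
    (W : Set V) (hWne : W.Nonempty) (hWproper : W ≠ Set.univ)
    (v₀ : V)
    (f : Sym2 V) (hf : f ∈ G.edgeSet)
    (cm cp : ℝ) (hc0 : 0 < cm) (hc : cm < cp)
    (κ : Sym2 V → ℝ) (hκpos : ∀ e ∈ G.edgeSet, 0 < κ e) :
    gdet G (Function.update κ f cp) W * gdet G (Function.update κ f cm) {v₀}
      ≤ gdet G (Function.update κ f cp) {v₀} * gdet G (Function.update κ f cm) W := by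
  induction f using Sym2.ind with | _ a b
  have hm : ∀ e ∈ G.edgeSet, 0 < Function.update κ s(a, b) cm e := by
    intro e he
    by_cases hef : e = s(a, b)
    · rwa [hef, Function.update_self]
    · rw [Function.update_of_ne hef]
      exact hκpos e he
  have hv := Set.singleton_nonempty v₀
  have hDW := gdet_pos hconn hm hWne
  have hD := gdet_pos hconn hm hv
  have hR := mul_le_mul_of_nonneg_left (effRes_le_effRes_singleton hconn hm hWne v₀ a b)
    (sub_pos.2 hc).le
  rw [gdet_update hf cm cp (isUnit_iff_ne_zero.2 hDW.ne'),
    gdet_update hf cm cp (isUnit_iff_ne_zero.2 hD.ne')]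
  nlinarith [mul_le_mul_of_nonneg_left hR (mul_pos hDW hD).le]
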